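/- Let G(X) = Σ_{i=0}^∞ t_i X^i be the generating function of the Thue–Morse sequence, viewed as a formal power series over F_2. Then (X + 1)^3 · G(X)^2 + (X + 1)^2 · G(X) + X = 0 in F_2[[X]]. -/

import Mathlib

/-- `patternCount k n` is the number of indices `i ≥ 0` such that the binary digits of `n`
in positions `i, i+1, …, i+k-1` are all equal to `1`. For `k = 1` this is the binary
digit sum `s₁(n)`. -/
noncomputable def patternCount (k n : ℕ) : ℕ := {i : ℕ | ∀ j < k, n.testBit (i + j)}.ncard

/-- The Thue–Morse sequence over `F₂`: `t n ≡ s₁(n) (mod 2)`. -/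
noncomputable def thueMorse (n : ℕ) : ZMod 2 := (patternCount 1 n : ZMod 2)

/-- The pattern sequence `P_k` over `F₂`: `p n ≡ s_k(n) (mod 2)`. -/
noncomputable def patternSeq (k n : ℕ) : ZMod 2 := (patternCount k n : ZMod 2)

open PowerSeries

theorem setOf_testBit_finite (n : ℕ) : {i : ℕ | n.testBit i = true}.Finite := by
  refine (Set.finite_lt_nat n).subset fun i hi => ?_
  exact Nat.lt_of_lt_of_le Nat.lt_two_pow_self (Nat.ge_two_pow_of_testBit hi)

theorem patternCount_one_eq_ncard (n : ℕ) :
    patternCount 1 n = {i : ℕ | n.testBit i = true}.ncard := by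
  simp [patternCount]

theorem thueMorse_two_mul (n : ℕ) : thueMorse (2 * n) = thueMorse n := by
  have h : {i : ℕ | (2 * n).testBit i = true} = Nat.succ '' {i : ℕ | n.testBit i = true} := by
    ext i
    cases i <;> simp [Nat.testBit_succ]
  simp only [thueMorse, patternCount_one_eq_ncard, h,
    Set.ncard_image_of_injective _ Nat.succ_injective]

theorem thueMorse_two_mul_add_one (n : ℕ) : thueMorse (2 * n + 1) = thueMorse n + 1 := by
  have h : {i : ℕ | (2 * n + 1).testBit i = true} =
      insert 0 (Nat.succ '' {i : ℕ | n.testBit i = true}) := by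
    ext i
    cases i with
    | zero => simp
    | succ i =>
      have : (2 * n + 1) / 2 = n := by omega
      simp [Nat.testBit_succ, this]
  simp only [thueMorse, patternCount_one_eq_ncard, h]
  rw [Set.ncard_insert_of_notMem (by simp) ((setOf_testBit_finite n).image _),
    Set.ncard_image_of_injective _ Nat.succ_injective, Nat.cast_add, Nat.cast_one]

theorem PowerSeries.expand_two_eq_sq (f : PowerSeries (ZMod 2)) :
    expand 2 two_ne_zero f = f ^ 2 := by
  have h := MvPowerSeries.map_frobenius_expand 2 two_ne_zero (f := f)
  rwa [ZMod.frobenius_zmod, MvPowerSeries.map_id] at h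

theorem mk_thueMorse_eq :
    mk thueMorse = (1 + X) * expand 2 two_ne_zero (mk thueMorse)
      + X * expand 2 two_ne_zero (mk 1) := by
  ext n
  rw [add_mul, one_mul]
  obtain ⟨m, rfl | rfl⟩ := n.even_or_odd'
  · have h (f : PowerSeries (ZMod 2)) : coeff (2 * m) (X * expand 2 two_ne_zero f) = 0 := by
      cases m with
      | zero => simp
      | succ m =>
        rw [show 2 * (m + 1) = 2 * m + 1 + 1 by ring, coeff_succ_X_mul]
        exact coeff_expand_of_not_dvd _ _ _ (by omega)
    simp only [map_add, h, coeff_expand_mul, coeff_mk, thueMorse_two_mul, add_zero]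
  · have h (f : PowerSeries (ZMod 2)) : coeff (2 * m + 1) (expand 2 two_ne_zero f) = 0 :=
      coeff_expand_of_not_dvd _ _ _ (by omega)
    simp only [map_add, h, coeff_succ_X_mul, coeff_expand_mul, coeff_mk,
      thueMorse_two_mul_add_one, zero_add, Pi.one_apply]

/-- The generating function G of the Thue–Morse sequence satisfies
(X+1)^3 * G^2 + (X+1)^2 * G + X = 0 in F_2[[X]]. -/
theorem thueMorse_generating_function_algebraic :
    ((PowerSeries.X : PowerSeries (ZMod 2)) + 1) ^ 3 * (PowerSeries.mk thueMorse) ^ 2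
      + ((PowerSeries.X : PowerSeries (ZMod 2)) + 1) ^ 2 * (PowerSeries.mk thueMorse)
      + (PowerSeries.X : PowerSeries (ZMod 2)) = 0 := by
  have hG := mk_thueMorse_eq
  have hA : expand 2 two_ne_zero (mk 1 : PowerSeries (ZMod 2)) * (1 - X ^ 2) = 1 := by
    rw [← expand_X 2 two_ne_zero, ← map_one (expand 2 two_ne_zero), ← map_sub, ← map_mul,
      mk_one_mul_one_sub_eq_one]
  rw [expand_two_eq_sq (mk thueMorse)] at hG
  have h2 : (2 : PowerSeries (ZMod 2)) = 0 := by
    rw [← map_ofNat (C (R := ZMod 2)) 2, show (OfNat.ofNat 2 : ZMod 2) = 0 from rfl, map_zero]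
  generalize mk thueMorse = G at *
  generalize expand 2 two_ne_zero (mk 1 : PowerSeries (ZMod 2)) = A at *
  linear_combination (X + 1) ^ 2 * hG + X * hA
    + ((X + 1) ^ 3 * G ^ 2 + X * A * (X + X ^ 2) + X) * h2
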